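/- Let X be a set with a K-quasi-metric d (K ≥ 1), and let w,x,y,z be four pairwise distinct points of X. If d(w,z)d(x,y) ≠ 0, then max( d(w,x)d(y,z)/(d(w,z)d(x,y)), d(w,y)d(x,z)/(d(w,z)d(x,y)) ) ≥ 1/K². -/

import Mathlib

/-- If `p` is bounded by `max a e` and `max c b`, and `q` by `max a c` and `max e b`, then
`p * q` is bounded by `max (a * b) (c * e)`. -/
theorem mul_le_max_mul_of_le_max {a b c e p q : ℝ} (hp : 0 ≤ p) (hq : 0 ≤ q)
    (hae : p ≤ max a e) (hcb : p ≤ max c b) (hac : q ≤ max a c) (heb : q ≤ max e b) :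
    p * q ≤ max (a * b) (c * e) := by
  have key {s t u v : ℝ} (hs : 0 ≤ s) (ht : 0 ≤ t) (hsu : s ≤ u) (htv : t ≤ v) :
      s * t ≤ u * v := mul_le_mul hsu htv ht (hs.trans hsu)
  by_contra! h
  obtain ⟨h₁, h₂⟩ := max_lt_iff.1 h
  have hab : ¬ (p ≤ a ∧ q ≤ b) := fun k => by linarith [key hp hq k.1 k.2]
  have hba : ¬ (q ≤ a ∧ p ≤ b) := fun k => by linarith [key hq hp k.1 k.2]
  have hce : ¬ (p ≤ c ∧ q ≤ e) := fun k => by linarith [key hp hq k.1 k.2]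
  have hec : ¬ (q ≤ c ∧ p ≤ e) := fun k => by linarith [key hq hp k.1 k.2]
  rw [le_max_iff] at hae hcb hac heb
  rcases le_total p q with hpq | hpq <;> rcases hae with _ | _ <;> rcases hcb with _ | _ <;>
    rcases hac with _ | _ <;> rcases heb with _ | _ <;>
    first
      | exact hab ⟨by linarith, by linarith⟩
      | exact hba ⟨by linarith, by linarith⟩
      | exact hce ⟨by linarith, by linarith⟩
      | exact hec ⟨by linarith, by linarith⟩

/-- (corner)-condition for quasi-metrics: for pairwise distinct
points, the maximum of the two normalized cross-ratios is at least 1/K². -/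
theorem quasimetric_corner_condition {X : Type*} (d : X → X → ℝ) (K : ℝ)
    (hK : 1 ≤ K)
    (hnonneg : ∀ x y, 0 ≤ d x y)
    (hzero : ∀ x y, d x y = 0 ↔ x = y)
    (hsymm : ∀ x y, d x y = d y x)
    (hquasi : ∀ x y z, d x z ≤ K * max (d x y) (d y z))
    (w x y z : X)
    (hwx : w ≠ x) (hwy : w ≠ y) (hwz : w ≠ z)
    (hxy : x ≠ y) (hxz : x ≠ z) (hyz : y ≠ z)
    (h0 : d w z * d x y ≠ 0) :
    1 / K ^ 2 ≤
      max (d w x * d y z / (d w z * d x y)) (d w y * d x z / (d w z * d x y)) := by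
  have hK0 : 0 < K := by linarith
  have hpos : 0 < d w z * d x y :=
    lt_of_le_of_ne (mul_nonneg (hnonneg _ _) (hnonneg _ _)) h0.symm
  have hdiv (u v t : X) : d u t / K ≤ max (d u v) (d v t) :=
    (div_le_iff₀' hK0).2 (hquasi u v t)
  have hmain := mul_le_max_mul_of_le_max (div_nonneg (hnonneg w z) hK0.le)
    (div_nonneg (hnonneg x y) hK0.le) (hdiv w x z) (hdiv w y z)
    (hsymm x w ▸ hdiv x w y) (hsymm z y ▸ hdiv x z y)
  rw [max_div_div_right hpos.le, le_div_iff₀ hpos]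
  calc 1 / K ^ 2 * (d w z * d x y) = d w z / K * (d x y / K) := by ring
    _ ≤ _ := hmain
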